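/- Let R be a regular local ring of prime characteristic p > 0 and let P ⊊ R be a nonzero prime ideal. Then for every power q = p^e with e ≥ 1, the ideal (P^{[q]} : P) is a P-primary ideal. -/

import Mathlib

/-!  Common definitions: F-singularities of pairs `(R, a₁^{t₁} ⋯ a_k^{t_k})`
(Takagi, "F-singularities of pairs and Inversion of Adjunction of arbitrary
codimension"). -/

/-- The subring of `p`-th powers of `R`. -/
def pthPowers (R : Type*) [CommRing R] (p : ℕ) : Subring R :=
  Subring.closure (Set.range fun x : R => x ^ p)

/-- `R` is F-finite: it is a finitely generated module over its subring of `p`-th powers. -/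
def FFinite (R : Type*) [CommRing R] (p : ℕ) : Prop :=
  Module.Finite (pthPowers R p) R

/-- `c^{1/q} R → R^{1/q}` splits as an `R`-module homomorphism: there is an additive
map `φ : R → R` with `φ (a ^ q * x) = a * φ x` for all `a x` and `φ c = 1`. -/
def SplitsAlong (R : Type*) [CommRing R] (c : R) (q : ℕ) : Prop :=
  ∃ φ : R →+ R, (∀ a x : R, φ (a ^ q * x) = a * φ x) ∧ φ c = 1

/-- Membership in `R°`: `c` lies in no minimal prime of `R`. -/
def NotInMinimalPrimes (R : Type*) [CommRing R] (c : R) : Prop :=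
  ∀ P ∈ minimalPrimes R, c ∉ P

/-- F-purity of the pair `(R, a₁^{t₁} ⋯ a_k^{t_k})`: for all sufficiently large
`q = p^e` there is `d ∈ a₁^{⌊t₁(q-1)⌋} ⋯ a_k^{⌊t_k(q-1)⌋}` such that
`d^{1/q} R → R^{1/q}` splits. -/
def FPurePair (R : Type*) [CommRing R] (p : ℕ) {k : ℕ}
    (a : Fin k → Ideal R) (t : Fin k → ℝ) : Prop :=
  ∃ e₀ : ℕ, ∀ e : ℕ, e₀ ≤ e →
    ∃ d ∈ ∏ i, a i ^ ⌊t i * ((p ^ e : ℝ) - 1)⌋₊, SplitsAlong R d (p ^ e)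

/-- Strong F-regularity of the pair `(R, a₁^{t₁} ⋯ a_k^{t_k})`: for every `c ∈ R°`
there are `q = p^e` and `d ∈ a₁^{⌊t₁(q-1)⌋} ⋯ a_k^{⌊t_k(q-1)⌋}` such that
`(cd)^{1/q} R → R^{1/q}` splits. -/
def StronglyFRegularPair (R : Type*) [CommRing R] (p : ℕ) {k : ℕ}
    (a : Fin k → Ideal R) (t : Fin k → ℝ) : Prop :=
  ∀ c : R, NotInMinimalPrimes R c →
    ∃ e : ℕ, ∃ d ∈ ∏ i, a i ^ ⌊t i * ((p ^ e : ℝ) - 1)⌋₊, SplitsAlong R (c * d) (p ^ e)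

/-- Pure F-regularity of the pair `(R, a₁^{t₁} ⋯ a_k^{t_k})`: for every `c ∈ R°` not
in any minimal prime of `a₁ ⋯ a_k`, for all sufficiently large `q = p^e` there is
`d ∈ a₁^{⌊t₁(q-1)⌋} ⋯ a_k^{⌊t_k(q-1)⌋}` such that `(cd)^{1/q} R → R^{1/q}` splits. -/
def PurelyFRegularPair (R : Type*) [CommRing R] (p : ℕ) {k : ℕ}
    (a : Fin k → Ideal R) (t : Fin k → ℝ) : Prop :=
  ∀ c : R, NotInMinimalPrimes R c → (∀ P ∈ (∏ i, a i).minimalPrimes, c ∉ P) →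
    ∃ e₀ : ℕ, ∀ e : ℕ, e₀ ≤ e →
      ∃ d ∈ ∏ i, a i ^ ⌊t i * ((p ^ e : ℝ) - 1)⌋₊, SplitsAlong R (c * d) (p ^ e)

/-- A strongly F-regular ring: for every `c ∈ R°` there is `q = p^e` such that
`c^{1/q} R → R^{1/q}` splits. -/
def StronglyFRegularRing (R : Type*) [CommRing R] (p : ℕ) : Prop :=
  ∀ c : R, NotInMinimalPrimes R c → ∃ e : ℕ, SplitsAlong R c (p ^ e)

/-- The Frobenius power `J^{[q]}`, the ideal generated by `q`-th powers of elements
of `J`. -/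
def frobeniusPower {R : Type*} [CommRing R] (J : Ideal R) (q : ℕ) : Ideal R :=
  Ideal.span ((fun x => x ^ q) '' (J : Set R))

/-- A regular local ring: a Noetherian local ring whose maximal ideal is generated
by `dim R` elements. -/
def IsRegularLocal (R : Type*) [CommRing R] [IsLocalRing R] : Prop :=
  IsNoetherianRing R ∧
    ∃ s : Finset R, Ideal.span (s : Set R) = IsLocalRing.maximalIdeal R ∧
      (s.card : WithBot ℕ∞) = ringKrullDim R

/-- The height of a prime ideal. -/
noncomputable def primeHeight {R : Type*} [CommRing R] (P : Ideal R) (hP : P.IsPrime) : ℕ∞ :=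
  Order.height (⟨P, hP⟩ : PrimeSpectrum R)

/-- `I` is an unmixed reduced ideal of height `h`: `I` is radical and every minimal
prime of `I` has height `h`. -/
def UnmixedReducedOfHeight {R : Type*} [CommRing R] (I : Ideal R) (h : ℕ) : Prop :=
  I.IsRadical ∧ ∀ (P : Ideal R) (hP : P.IsPrime), P ∈ I.minimalPrimes →
    primeHeight P hP = (h : ℕ∞)

section

open IsLocalRing RingTheory.Sequence

section Length

variable {R S : Type*} [CommRing R] [CommRing S]

theorem length_quotient_eq_colon_add_sup (J : Ideal R) (a : R) :
    Module.length R (R ⧸ J) =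
      Module.length R (R ⧸ J.colon {a}) + Module.length R (R ⧸ (J ⊔ Ideal.span {a})) := by
  have hker : J.colon {a} = LinearMap.ker (LinearMap.toSpanSingleton R (R ⧸ J) (J.mkQ a)) := by
    ext r
    rw [Submodule.mem_colon_singleton, LinearMap.mem_ker, LinearMap.toSpanSingleton_apply,
      ← map_smul, Submodule.mkQ_apply, Submodule.Quotient.mk_eq_zero]
  refine Module.length_eq_add_of_exact
    ((J.colon {a}).liftQ (LinearMap.toSpanSingleton R (R ⧸ J) (J.mkQ a)) hker.le)
    (Submodule.factor (le_sup_left : J ≤ J ⊔ Ideal.span {a})) ?_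
    (Submodule.factor_surjective _) ?_
  · rw [← LinearMap.ker_eq_bot]
    exact Submodule.ker_liftQ_eq_bot' _ _ hker
  · rw [LinearMap.exact_iff, Submodule.range_liftQ, LinearMap.range_toSpanSingleton]
    ext y
    obtain ⟨y, rfl⟩ := J.mkQ_surjective y
    rw [Submodule.mkQ_apply, LinearMap.mem_ker, Submodule.factor, Submodule.mapQ_apply,
      LinearMap.id_apply, Submodule.Quotient.mk_eq_zero, Submodule.mem_span_singleton, Submodule.mkQ_apply,
      sup_comm J, Ideal.mem_span_singleton_sup]
    constructor
    · rintro ⟨r, b, hb, rfl⟩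
      refine ⟨r, ?_⟩
      rw [← Submodule.Quotient.mk_smul, Submodule.Quotient.eq]
      simpa using hb
    · rintro ⟨r, hr⟩
      rw [← Submodule.Quotient.mk_smul, eq_comm, Submodule.Quotient.eq] at hr
      exact ⟨r, _, hr, by simp⟩

theorem Ideal.eq_of_le_of_length_quotient_le {I J : Ideal R} (h : I ≤ J)
    (hlen : Module.length R (R ⧸ I) ≤ Module.length R (R ⧸ J))
    (hJ : Module.length R (R ⧸ J) ≠ ⊤) : I = J := by
  by_contra hne
  rw [Module.length_quotient] at hlen hJ
  rw [Module.length_quotient] at hlen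
  have := Order.coheight_strictAnti (lt_of_le_of_ne h hne) hJ.lt_top
  exact this.not_ge hlen

theorem length_quotient_le_of_le {I J : Ideal R} (h : I ≤ J) :
    Module.length R (R ⧸ J) ≤ Module.length R (R ⧸ I) :=
  Module.length_le_of_surjective (Submodule.factor h) (Submodule.factor_surjective h)

theorem length_quotient_top : Module.length R (R ⧸ (⊤ : Ideal R)) = 0 :=
  Module.length_eq_zero

variable [IsLocalRing R]

theorem length_quotient_maximalIdeal : Module.length R (R ⧸ maximalIdeal R) = 1 := by
  rw [Module.length_eq_one_iff, isSimpleModule_iff_isCoatom, ← Ideal.isMaximal_def]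
  infer_instance

theorem exists_colon_eq_maximalIdeal {J : Ideal R} (hJ : J ≠ ⊤) {k : ℕ}
    (hk : maximalIdeal R ^ k ≤ J) : ∃ a, J.colon {a} = maximalIdeal R := by
  induction k with
  | zero => exact absurd (top_le_iff.mp (by simpa using hk)) hJ
  | succ k ih =>
    by_cases h : maximalIdeal R ^ k ≤ J
    · exact ih h
    obtain ⟨a, ha, haJ⟩ := SetLike.not_le_iff_exists.mp h
    refine ⟨a, ((maximalIdeal.isMaximal R).eq_of_le (fun htop => haJ ?_) fun r hr => ?_).symm⟩
    · simpa [Submodule.mem_colon_singleton] using (Ideal.eq_top_iff_one _).mp htop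
    · rw [Submodule.mem_colon_singleton]
      exact hk (pow_succ' (maximalIdeal R) k ▸ Ideal.mul_mem_mul hr ha)

theorem length_quotient_map_le [IsNoetherianRing R] (φ : R →+* S) (J : Ideal R) {k : ℕ}
    (hk : maximalIdeal R ^ k ≤ J) :
    Module.length S (S ⧸ J.map φ) ≤
      Module.length R (R ⧸ J) * Module.length S (S ⧸ (maximalIdeal R).map φ) := by
  induction J using IsNoetherian.induction with
  | _ J ih =>
  by_cases hJ : J = ⊤
  · subst hJ
    rw [Ideal.map_top, length_quotient_top]
    exact zero_le
  obtain ⟨a, ha⟩ := exists_colon_eq_maximalIdeal hJ hk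
  have hlt : J < J ⊔ Ideal.span {a} := by
    refine lt_of_le_of_ne le_sup_left fun h => ?_
    have haJ : a ∈ J := h ▸ Ideal.mem_sup_right (Ideal.mem_span_singleton_self a)
    have : (1 : R) ∈ J.colon {a} := by simpa [Submodule.mem_colon_singleton] using haJ
    exact (maximalIdeal R).ne_top_iff_one.mp Ideal.IsPrime.ne_top' (ha ▸ this)
  have hle : (maximalIdeal R).map φ ≤ (Ideal.map φ J).colon {φ a} := by
    rw [Ideal.map_le_iff_le_comap, ← ha]
    intro r hr
    rw [Submodule.mem_colon_singleton] at hr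
    rw [Ideal.mem_comap, Submodule.mem_colon_singleton, smul_eq_mul, ← map_mul]
    exact Ideal.mem_map_of_mem _ hr
  have h : Module.length S (S ⧸ Ideal.map φ (J ⊔ Ideal.span {a})) ≤ _ :=
    ih _ hlt (hk.trans le_sup_left)
  rw [Ideal.map_sup, Ideal.map_span, Set.image_singleton] at h
  rw [length_quotient_eq_colon_add_sup (Ideal.map φ J) (φ a),
    length_quotient_eq_colon_add_sup J a, ha, length_quotient_maximalIdeal, add_mul, one_mul]
  exact add_le_add (length_quotient_le_of_le hle) h

theorem length_quotient_map_sup_and_colon [IsNoetherianRing R] (φ : R →+* S) {J : Ideal R} {k : ℕ}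
    (hk : maximalIdeal R ^ k ≤ J) (hJ : Module.length R (R ⧸ J) ≠ ⊤)
    (hm : Module.length S (S ⧸ (maximalIdeal R).map φ) ≠ ⊤)
    (heq : Module.length S (S ⧸ J.map φ) =
      Module.length R (R ⧸ J) * Module.length S (S ⧸ (maximalIdeal R).map φ)) (a : R) :
    Module.length S (S ⧸ (J ⊔ Ideal.span {a}).map φ) = Module.length R (R ⧸ (J ⊔ Ideal.span {a})) *
        Module.length S (S ⧸ (maximalIdeal R).map φ) ∧
      (J.map φ).colon {φ a} = (J.colon {a}).map φ := by
  have hJcolon : J ≤ J.colon {a} := fun r hr => by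
    rw [Submodule.mem_colon_singleton]
    exact J.mul_mem_right _ hr
  have hle : (J.colon {a}).map φ ≤ (J.map φ).colon {φ a} := by
    rw [Ideal.map_le_iff_le_comap]
    intro r hr
    rw [Submodule.mem_colon_singleton] at hr
    rw [Ideal.mem_comap, Submodule.mem_colon_singleton, smul_eq_mul, ← map_mul]
    exact Ideal.mem_map_of_mem _ hr
  have h1 := length_quotient_map_le φ (J ⊔ Ideal.span {a}) (hk.trans le_sup_left)
  have h2 := length_quotient_map_le φ (J.colon {a}) (hk.trans hJcolon)
  have h3 := length_quotient_le_of_le hle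
  have h4 := length_quotient_eq_colon_add_sup (J.map φ) (φ a)
  have h5 := length_quotient_eq_colon_add_sup J a
  rw [← Set.image_singleton, ← Ideal.map_span, ← Ideal.map_sup, Set.image_singleton] at h4
  rw [h4, h5, add_mul] at heq
  rw [h5] at hJ
  have ha1 := (WithTop.mul_lt_top (lt_of_le_of_lt le_self_add hJ.lt_top) hm.lt_top).ne
  have ha2 := (WithTop.mul_lt_top (lt_of_le_of_lt le_add_self hJ.lt_top) hm.lt_top).ne
  have hc := ne_top_of_le_ne_top ha1 (h3.trans h2)
  have hB := le_antisymm h1 (le_of_not_gt fun hlt => by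
    exact (ENat.add_lt_add_of_le_of_lt hc (h3.trans h2) hlt).ne heq)
  refine ⟨hB, (Ideal.eq_of_le_of_length_quotient_le hle ?_ hc).symm⟩
  rw [hB] at heq
  exact h2.trans (ENat.add_left_injective_of_ne_top ha2 heq).ge

end Length

section RegularSequence

variable {R : Type*} [CommRing R]

theorem length_quotient_sup_span_pow {J : Ideal R} {x : R} (hx : ∀ y, x * y ∈ J → y ∈ J) (n : ℕ) :
    Module.length R (R ⧸ (J ⊔ Ideal.span {x ^ n})) =
      n * Module.length R (R ⧸ (J ⊔ Ideal.span {x})) := by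
  induction n with
  | zero =>
    rw [pow_zero, Ideal.span_singleton_one, sup_top_eq, length_quotient_top, Nat.cast_zero,
      zero_mul]
  | succ n ih =>
    have hpow (y : R) (hy : x ^ n * y ∈ J) : y ∈ J := by
      clear ih
      induction n with
      | zero => simpa using hy
      | succ n ih => exact ih (hx _ (by rwa [← mul_assoc, ← pow_succ']))
    have hcolon : (J ⊔ Ideal.span {x ^ (n + 1)}).colon {x ^ n} = J ⊔ Ideal.span {x} := by
      ext r
      rw [Submodule.mem_colon_singleton, smul_eq_mul, sup_comm, sup_comm J,
        Ideal.mem_span_singleton_sup, Ideal.mem_span_singleton_sup]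
      constructor
      · rintro ⟨a, b, hb, h⟩
        refine ⟨a, r - a * x, hpow _ ?_, by ring⟩
        rwa [show x ^ n * (r - a * x) = b by linear_combination -h]
      · rintro ⟨a, b, hb, rfl⟩
        exact ⟨a, b * x ^ n, J.mul_mem_right _ hb, by ring⟩
    have hsup : J ⊔ Ideal.span {x ^ (n + 1)} ⊔ Ideal.span {x ^ n} = J ⊔ Ideal.span {x ^ n} := by
      rw [sup_assoc, sup_eq_right.mpr
        (Ideal.span_singleton_le_span_singleton.mpr (pow_dvd_pow x n.le_succ))]
    rw [length_quotient_eq_colon_add_sup _ (x ^ n), hcolon, hsup, ih, Nat.cast_succ, add_mul,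
      one_mul, add_comm]

theorem Ideal.ofList_eq_of_perm {l l' : List R} (h : l.Perm l') :
    Ideal.ofList l = Ideal.ofList l' := by
  unfold Ideal.ofList
  congr 1
  ext r
  exact h.mem_iff

theorem isWeaklyRegular_append_singleton_iff (l : List R) (x : R) :
    IsWeaklyRegular R (l ++ [x]) ↔
      IsWeaklyRegular R l ∧ ∀ y, x * y ∈ Ideal.ofList l → y ∈ Ideal.ofList l := by
  rw [isWeaklyRegular_append_iff, isWeaklyRegular_singleton_iff,
    isSMulRegular_quotient_iff_mem_of_smul_mem]
  simp

variable [IsLocalRing R] [IsNoetherianRing R]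

theorem isWeaklyRegular_map_pow_append_and_length (n : ℕ) (hn : n ≠ 0) (l s : List R)
    (hreg : IsWeaklyRegular R (l ++ s)) (hmem : ∀ r ∈ l ++ s, r ∈ maximalIdeal R) :
    IsWeaklyRegular R (l.map (· ^ n) ++ s) ∧
      Module.length R (R ⧸ Ideal.ofList (l.map (· ^ n) ++ s)) =
        (n : ℕ∞) ^ l.length * Module.length R (R ⧸ Ideal.ofList (l ++ s)) := by
  induction l generalizing s with
  | nil => exact ⟨hreg, by rw [List.length_nil, pow_zero, one_mul, List.map_nil]⟩
  | cons x l ih =>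
    have hperm (y : R) : (l ++ s ++ [y]).Perm (l ++ y :: s) := by
      rw [List.append_assoc]
      exact (List.perm_append_comm (l₁ := s) (l₂ := [y])).append_left l
    have hperm' : (x :: l ++ s).Perm (l ++ s ++ [x]) :=
      List.perm_append_comm (l₁ := [x]) (l₂ := l ++ s)
    have hperm'' : (l.map (· ^ n) ++ x ^ n :: s).Perm ((x :: l).map (· ^ n) ++ s) :=
      List.perm_middle
    have h1 := isWeaklyRegular_of_perm_of_subset_maximalIdeal hreg hperm' hmem
    have h2 := ((isWeaklyRegular_append_singleton_iff _ _).mp h1).2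
    have hmem' : ∀ r ∈ l ++ x ^ n :: s, r ∈ maximalIdeal R := by
      intro r hr
      rcases List.mem_append.mp hr with hr | hr
      · exact hmem r (by simp [hr])
      · rcases List.mem_cons.mp hr with rfl | hr
        · exact Ideal.pow_mem_of_mem _ (hmem x (by simp)) n (Nat.pos_of_ne_zero hn)
        · exact hmem r (by simp [hr])
    have h3 : IsWeaklyRegular R (l ++ s ++ [x ^ n]) := by
      rw [isWeaklyRegular_append_iff, isWeaklyRegular_singleton_iff] at h1 ⊢
      exact ⟨h1.1, h1.2.pow n⟩
    have h4 := isWeaklyRegular_of_perm_of_subset_maximalIdeal h3 (hperm _)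
      fun r hr => hmem' r ((hperm _).mem_iff.mp hr)
    obtain ⟨h5, h6⟩ := ih (x ^ n :: s) h4 hmem'
    have hmem'' : ∀ r ∈ (l.map (· ^ n) ++ x ^ n :: s), r ∈ maximalIdeal R := by
      intro r hr
      rcases List.mem_append.mp hr with hr | hr
      · obtain ⟨t, ht, rfl⟩ := List.mem_map.mp hr
        exact Ideal.pow_mem_of_mem _ (hmem t (by simp [ht])) n (Nat.pos_of_ne_zero hn)
      · exact hmem' r (by simp [List.mem_cons.mp hr])
    refine ⟨isWeaklyRegular_of_perm_of_subset_maximalIdeal h5 hperm'' hmem'', ?_⟩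
    rw [← Ideal.ofList_eq_of_perm hperm'', h6, Ideal.ofList_eq_of_perm hperm',
      ← Ideal.ofList_eq_of_perm (hperm (x ^ n)), Ideal.ofList_append, Ideal.ofList_append _ [x],
      Ideal.ofList_singleton, Ideal.ofList_singleton, length_quotient_sup_span_pow h2,
      List.length_cons, pow_succ, mul_assoc]

end RegularSequence

section Frobenius

variable {R : Type*} [CommRing R] [IsLocalRing R] [IsNoetherianRing R]

theorem length_quotient_map_eq_of_le {S : Type*} [CommRing S] (φ : R →+* S) {J₀ J : Ideal R}
    (hle : J₀ ≤ J) {k : ℕ} (hk : maximalIdeal R ^ k ≤ J₀)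
    (hJ₀ : Module.length R (R ⧸ J₀) ≠ ⊤)
    (hm : Module.length S (S ⧸ (maximalIdeal R).map φ) ≠ ⊤)
    (heq : Module.length S (S ⧸ J₀.map φ) =
      Module.length R (R ⧸ J₀) * Module.length S (S ⧸ (maximalIdeal R).map φ)) :
    Module.length S (S ⧸ J.map φ) =
      Module.length R (R ⧸ J) * Module.length S (S ⧸ (maximalIdeal R).map φ) := by
  classical
  obtain ⟨T, rfl⟩ := IsNoetherian.noetherian J
  suffices h : ∀ T : Finset R, Module.length S (S ⧸ (J₀ ⊔ Ideal.span (T : Set R)).map φ) =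
      Module.length R (R ⧸ (J₀ ⊔ Ideal.span (T : Set R))) *
        Module.length S (S ⧸ (maximalIdeal R).map φ) by
    have h := h T
    rwa [sup_eq_right.mpr hle] at h
  intro T
  induction T using Finset.induction_on with
  | empty => rwa [Finset.coe_empty, Ideal.span_empty, sup_bot_eq]
  | insert a T _ ih =>
    rw [Finset.coe_insert, Ideal.span_insert, sup_comm (Ideal.span {a}), ← sup_assoc]
    exact (length_quotient_map_sup_and_colon φ (hk.trans le_sup_left)
      (ne_top_of_le_ne_top hJ₀ (length_quotient_le_of_le le_sup_left)) hm ih a).1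

theorem colon_map_eq_of_forall_pow_le {S : Type*} [CommRing S] [IsLocalRing S] [IsNoetherianRing S]
    (φ : R →+* S) [IsLocalHom φ]
    (h : ∀ (J : Ideal R) (k : ℕ), maximalIdeal R ^ k ≤ J → ∀ a : R,
      (J.map φ).colon {φ a} = (J.colon {a}).map φ) (I : Ideal R) (a : R) :
    (I.map φ).colon {φ a} ≤ (I.colon {a}).map φ := by
  obtain ⟨k, hk⟩ := (maximalIdeal R).exists_pow_inf_eq_pow_smul
    (Submodule.span R {I.mkQ a} : Submodule R (R ⧸ I))
  have hAR (n : ℕ) : (I ⊔ maximalIdeal R ^ (n + k)).colon {a} ≤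
      I.colon {a} ⊔ maximalIdeal R ^ n := by
    intro r hr
    rw [Submodule.mem_colon_singleton, smul_eq_mul] at hr
    obtain ⟨i, hi, t, ht, hit⟩ := Submodule.mem_sup.mp hr
    have hmem : r • I.mkQ a ∈ maximalIdeal R ^ (n + k) • (⊤ : Submodule R (R ⧸ I)) ⊓
        Submodule.span R {I.mkQ a} := by
      refine ⟨?_, Submodule.smul_mem _ _ (Submodule.mem_span_singleton_self _)⟩
      have : r • I.mkQ a = t • I.mkQ 1 := by
        rw [← map_smul, ← map_smul, ← sub_eq_zero, ← map_sub, Submodule.mkQ_apply,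
          Submodule.Quotient.mk_eq_zero]
        rw [smul_eq_mul, smul_eq_mul, ← hit]
        simpa using hi
      rw [this]
      exact Submodule.smul_mem_smul ht trivial
    rw [hk _ (Nat.le_add_left k n), Nat.add_sub_cancel] at hmem
    obtain ⟨s, hs, hsr⟩ := Submodule.mem_smul_span_singleton.mp
      (Submodule.smul_mono le_rfl inf_le_right hmem)
    rw [← map_smul, ← map_smul, eq_comm, ← sub_eq_zero, ← map_sub, Submodule.mkQ_apply,
      Submodule.Quotient.mk_eq_zero, ← sub_smul] at hsr
    rw [← sub_add_cancel r s]
    exact Submodule.add_mem_sup (Submodule.mem_colon_singleton.mpr hsr) hs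
  intro b hb
  have hmaps : (maximalIdeal R).map φ ≤ maximalIdeal S :=
    ((local_hom_TFAE φ).out 0 2).mp ‹_›
  have hn (n : ℕ) : b ∈ (I.colon {a}).map φ ⊔ maximalIdeal S ^ n := by
    have h1 : b ∈ ((I ⊔ maximalIdeal R ^ (n + k)).map φ).colon {φ a} := by
      rw [Submodule.mem_colon_singleton] at hb ⊢
      exact Ideal.map_mono le_sup_left hb
    rw [h _ (n + k) le_sup_right] at h1
    have h2 := Ideal.map_mono (hAR n) h1
    rw [Ideal.map_sup, Ideal.map_pow] at h2
    exact sup_le_sup_left (Ideal.pow_right_mono hmaps n) _ h2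
  set K := (I.colon {a}).map φ
  have hbot := Ideal.iInf_pow_smul_eq_bot_of_isLocalRing (M := S ⧸ K) (maximalIdeal S)
    Ideal.IsPrime.ne_top'
  rw [← Submodule.Quotient.mk_eq_zero, ← Submodule.mem_bot (R := S), ← hbot, Submodule.mem_iInf]
  intro n
  obtain ⟨c, hc, t, ht, hct⟩ := Submodule.mem_sup.mp (hn n)
  have : (Submodule.Quotient.mk b : S ⧸ K) = t • Submodule.Quotient.mk 1 := by
    rw [← Submodule.Quotient.mk_smul, Submodule.Quotient.eq, ← hct]
    simpa using hc
  rw [this]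
  exact Submodule.smul_mem_smul ht trivial

/-- The flatness of Frobenius on a regular local ring, for colon ideals by one element. -/
theorem colon_map_iterateFrobenius (p : ℕ) [ExpChar R p] (e : ℕ) {rs : List R}
    (hreg : IsWeaklyRegular R rs) (hrs : Ideal.ofList rs = maximalIdeal R) (I : Ideal R) (a : R) :
    (I.map (iterateFrobenius R p e)).colon {iterateFrobenius R p e a} ≤
      (I.colon {a}).map (iterateFrobenius R p e) := by
  set φ := iterateFrobenius R p e
  have hφa (x : R) : φ x = x ^ p ^ e := iterateFrobenius_def p e x
  have hq : p ^ e ≠ 0 := (pow_pos (expChar_pos R p) e).ne'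
  have : IsLocalHom φ := ⟨fun x hx => by rwa [hφa, isUnit_pow_iff hq] at hx⟩
  refine colon_map_eq_of_forall_pow_le φ (fun J k hk a => ?_) I a
  have hmem : ∀ r ∈ rs ++ [], r ∈ maximalIdeal R := fun r hr => by
    rw [← hrs]
    exact Ideal.subset_span (by simpa using hr)
  have hlen (n : ℕ) (hn : n ≠ 0) :
      Module.length R (R ⧸ Ideal.ofList (rs.map (· ^ n))) = (n : ℕ∞) ^ rs.length := by
    have := (isWeaklyRegular_map_pow_append_and_length n hn rs [] (by simpa using hreg) hmem).2
    rwa [List.append_nil, List.append_nil, hrs, length_quotient_maximalIdeal, mul_one] at this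
  have hmap (n : ℕ) : (Ideal.ofList (rs.map (· ^ n))).map φ =
      Ideal.ofList (rs.map (· ^ (n * p ^ e))) := by
    rw [Ideal.map_ofList, List.map_map]
    congr 2
    funext x
    simp [hφa, pow_mul]
  have hm : Module.length R (R ⧸ (maximalIdeal R).map φ) = ((p ^ e : ℕ) : ℕ∞) ^ rs.length := by
    have := hmap 1
    simp only [pow_one, List.map_id', hrs, one_mul] at this
    rw [this, hlen _ hq]
  have hm' : Module.length R (R ⧸ (maximalIdeal R).map φ) ≠ ⊤ := by
    rw [hm]
    exact_mod_cast ENat.natCast_ne_top _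
  set J₀ := Ideal.ofList (rs.map (· ^ (k + 1)))
  have hle : J₀ ≤ J := by
    refine Ideal.span_le.mpr fun r hr => ?_
    obtain ⟨x, hx, rfl⟩ := List.mem_map.mp hr
    exact hk (Ideal.pow_le_pow_right k.le_succ (Ideal.pow_mem_pow (hmem x (by simp [hx])) _))
  have hfin : Module.length R (R ⧸ J₀) ≠ ⊤ := by
    rw [hlen _ k.succ_ne_zero]
    exact_mod_cast ENat.natCast_ne_top _
  obtain ⟨N, hN⟩ : ∃ N, maximalIdeal R ^ N ≤ J₀ := by
    refine Ideal.exists_pow_le_of_le_radical_of_fg ?_ (IsNoetherian.noetherian _)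
    rw [← hrs]
    refine Ideal.span_le.mpr fun r hr => ⟨k + 1, Ideal.subset_span ?_⟩
    exact List.mem_map_of_mem (f := (· ^ (k + 1))) hr
  have heq := length_quotient_map_eq_of_le φ hle hN hfin hm' (by
    rw [hmap, hlen _ (mul_ne_zero k.succ_ne_zero hq), hlen _ k.succ_ne_zero, hm, Nat.cast_mul,
      mul_pow])
  exact (length_quotient_map_sup_and_colon φ hk
    (ne_top_of_le_ne_top hfin (length_quotient_le_of_le hle)) hm' heq a).2

end Frobenius

section Regular

theorem Ideal.exists_ofList_cons_eq {R : Type*} [CommRing R] [IsLocalRing R] {rs : List R}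
    (hrs : ∀ r ∈ rs, r ∈ maximalIdeal R) {x : R} (hx : x ∈ Ideal.ofList rs)
    (hx2 : x ∉ maximalIdeal R ^ 2) :
    ∃ rs' : List R, rs'.length + 1 = rs.length ∧ Ideal.ofList (x :: rs') = Ideal.ofList rs := by
  induction rs generalizing x with
  | nil => simp_all
  | cons y t ih =>
    rw [Ideal.ofList_cons, Ideal.mem_span_singleton_sup] at hx
    obtain ⟨a, z, hz, rfl⟩ := hx
    have hy : y ∈ maximalIdeal R := hrs y (by simp)
    by_cases ha : IsUnit a
    · refine ⟨t, rfl, ?_⟩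
      obtain ⟨u, rfl⟩ := ha
      simp only [Ideal.ofList_cons]
      refine le_antisymm (sup_le ?_ le_sup_right) (sup_le ?_ le_sup_right)
      · rw [Ideal.span_singleton_le_iff_mem, Ideal.mem_span_singleton_sup]
        exact ⟨u, z, hz, rfl⟩
      · rw [Ideal.span_singleton_le_iff_mem, Ideal.mem_span_singleton_sup]
        refine ⟨(u⁻¹ : Rˣ), -((u⁻¹ : Rˣ) : R) * z, Ideal.mul_mem_left _ _ hz, ?_⟩
        rw [mul_add, ← mul_assoc, Units.inv_mul]
        ring
    · have hay : a * y ∈ maximalIdeal R ^ 2 := by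
        rw [pow_two]
        exact Ideal.mul_mem_mul ((mem_maximalIdeal a).mpr ha) hy
      obtain ⟨t', ht', hspan⟩ := ih (fun r hr => hrs r (by simp [hr])) hz
        fun hz2 => hx2 (add_mem hay hz2)
      refine ⟨y :: t', by simp [ht'], ?_⟩
      simp only [Ideal.ofList_cons] at hspan ⊢
      rw [← hspan]
      refine le_antisymm (sup_le ?_ (sup_le le_sup_left (le_sup_right.trans le_sup_right)))
        (sup_le (le_sup_left.trans le_sup_right) (sup_le ?_ (le_sup_right.trans le_sup_right)))
      · rw [Ideal.span_singleton_le_iff_mem, Ideal.mem_span_singleton_sup]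
        exact ⟨a, z, Ideal.mem_sup_left (Ideal.mem_span_singleton_self z), rfl⟩
      · rw [Ideal.span_singleton_le_iff_mem, Ideal.mem_span_singleton_sup]
        exact ⟨1, -(a * y), Ideal.mem_sup_left
          (Ideal.mem_span_singleton.mpr ⟨-a, by ring⟩), by ring⟩

theorem exists_mem_maximalIdeal_notMem_sq_notMem_minimalPrimes {R : Type*} [CommRing R]
    [IsLocalRing R] [IsNoetherianRing R] (hdim : ringKrullDim R ≠ 0) :
    ∃ x ∈ maximalIdeal R, x ∉ maximalIdeal R ^ 2 ∧ ∀ Q ∈ minimalPrimes R, x ∉ Q := by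
  classical
  by_contra! h
  set s := (minimalPrimes.finite_of_isNoetherianRing R).toFinset with hs
  have hcover : ((maximalIdeal R : Ideal R) : Set R) ⊆
      ((maximalIdeal R ^ 2 : Ideal R) : Set R) ∪ ((maximalIdeal R ^ 2 : Ideal R) : Set R) ∪
        ⋃ i ∈ (s : Set (Ideal R)), (i : Set R) := by
    intro x hx
    by_cases hx2 : x ∈ maximalIdeal R ^ 2
    · exact Or.inl (Or.inl hx2)
    · obtain ⟨Q, hQ, hxQ⟩ := h x hx hx2
      exact Or.inr (Set.mem_biUnion (by simpa [hs] using hQ) hxQ)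
  have hnot (Q : Ideal R) (hQ : Q ∈ minimalPrimes R) : ¬ maximalIdeal R ≤ Q := fun hle => by
    apply hdim
    have hm : maximalIdeal R ∈ minimalPrimes R := by
      rwa [(maximalIdeal.isMaximal R).eq_of_le hQ.1.1.ne_top hle]
    have := Ideal.height_eq_zero_iff.mpr hm
    rw [← maximalIdeal_height_eq_ringKrullDim, this]
    rfl
  have hsq : ¬ maximalIdeal R ≤ maximalIdeal R ^ 2 := fun hle => by
    have hbot := Submodule.eq_bot_of_le_smul_of_le_jacobson_bot (maximalIdeal R) (maximalIdeal R)
      (IsNoetherian.noetherian _) (by rwa [smul_eq_mul, ← pow_two])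
      (maximalIdeal_le_jacobson ⊥)
    obtain ⟨Q, hQ⟩ := Ideal.nonempty_minimalPrimes (bot_ne_top : (⊥ : Ideal R) ≠ ⊤)
    exact hnot Q hQ (hbot ▸ bot_le)
  rcases (Ideal.subset_union_prime' (f := id) (s := s) (fun i hi =>
    ((Set.Finite.mem_toFinset _).mp hi).1.1)).mp hcover with h | h | ⟨Q, hQ, h⟩
  · exact hsq h
  · exact hsq h
  · exact hnot Q ((Set.Finite.mem_toFinset _).mp hQ) h

theorem isDomain_of_isPrime_span_singleton {R : Type*} [CommRing R] [IsLocalRing R]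
    [IsNoetherianRing R] {x : R} (hx : x ∈ maximalIdeal R) (hprime : (Ideal.span {x}).IsPrime)
    (hmin : ∀ Q ∈ minimalPrimes R, x ∉ Q) : IsDomain R := by
  obtain ⟨Q, hQ, hle⟩ := Ideal.exists_minimalPrimes_le (bot_le : ⊥ ≤ Ideal.span {x})
  have hQp : Q.IsPrime := hQ.1.1
  have hbot : Q = ⊥ := by
    refine Submodule.eq_bot_of_le_smul_of_le_jacobson_bot (maximalIdeal R) Q
      (IsNoetherian.noetherian _) (fun y hy => ?_) (maximalIdeal_le_jacobson ⊥)
    obtain ⟨z, rfl⟩ := Ideal.mem_span_singleton'.mp (hle hy)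
    rw [mul_comm]
    exact Ideal.mul_mem_mul hx ((hQp.mem_or_mem hy).resolve_right (hmin Q hQ))
  subst hbot
  exact IsDomain.of_bot_isPrime R

/-- A Noetherian local ring whose maximal ideal is generated by at most `dim R` elements is a
domain, and its maximal ideal is generated by a weakly regular sequence. -/
theorem isDomain_and_exists_isWeaklyRegular (d : ℕ) : ∀ {R : Type*} [CommRing R] [IsLocalRing R]
    [IsNoetherianRing R] (rs : List R), Ideal.ofList rs = maximalIdeal R → rs.length = d →
      (d : WithBot ℕ∞) ≤ ringKrullDim R →
      IsDomain R ∧ ∃ ts : List R, Ideal.ofList ts = maximalIdeal R ∧ IsWeaklyRegular R ts := by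
  induction d with
  | zero =>
    intro R _ _ _ rs hrs hlen hdim
    obtain rfl := List.length_eq_zero_iff.mp hlen
    refine ⟨?_, [], hrs, IsWeaklyRegular.nil R R⟩
    have : (⊥ : Ideal R).IsPrime := by
      rw [← Ideal.ofList_nil, hrs]
      infer_instance
    exact IsDomain.of_bot_isPrime R
  | succ d ih =>
    intro R _ _ _ rs hrs hlen hdim
    obtain ⟨x, hxm, hx2, hxmin⟩ := exists_mem_maximalIdeal_notMem_sq_notMem_minimalPrimes (R := R)
      (fun h0 => by
        rw [h0] at hdim
        exact absurd (by exact_mod_cast hdim : d + 1 ≤ 0) (by simp))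
    obtain ⟨rs', hlen', hrs'⟩ := Ideal.exists_ofList_cons_eq
      (fun r hr => hrs ▸ Ideal.subset_span hr) (hrs ▸ hxm) hx2
    have hlt : Ideal.span {x} ≠ ⊤ := fun htop =>
      Ideal.IsPrime.ne_top' (top_le_iff.mp (htop ▸ (Ideal.span_singleton_le_iff_mem _).mpr hxm))
    have := Ideal.Quotient.nontrivial_iff.mpr hlt
    have : IsLocalRing (R ⧸ Ideal.span {x}) :=
      IsLocalRing.of_surjective' (Ideal.Quotient.mk _) Ideal.Quotient.mk_surjective
    have hmax : (maximalIdeal R).map (Ideal.Quotient.mk (Ideal.span {x})) =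
        maximalIdeal (R ⧸ Ideal.span {x}) :=
      IsLocalRing.map_maximalIdeal_of_surjective _ Ideal.Quotient.mk_surjective
    have hdim' : (d : WithBot ℕ∞) ≤ ringKrullDim (R ⧸ Ideal.span {x}) := by
      have h1 := Ideal.height_le_ringKrullDim_quotient_add_one hxm
      rw [maximalIdeal_height_eq_ringKrullDim] at h1
      by_contra! hlt
      have h2 := (hdim.trans h1).trans (ENat.WithBot.add_one_le_natCast_iff.mpr hlt)
      have h3 : d + 1 ≤ d := by exact_mod_cast h2
      omega
    have hspan : Ideal.ofList (rs'.map (Ideal.Quotient.mk (Ideal.span {x}))) =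
        maximalIdeal (R ⧸ Ideal.span {x}) := by
      rw [← Ideal.map_ofList, ← hmax, ← hrs, ← hrs', Ideal.ofList_cons, Ideal.map_sup,
        Ideal.map_quotient_self, bot_sup_eq]
    obtain ⟨hdom, ts, hts, hreg⟩ := ih _ hspan (by simp; omega) hdim'
    have hR := isDomain_of_isPrime_span_singleton hxm
      ((Ideal.Quotient.isDomain_iff_prime _).mp hdom) hxmin
    refine ⟨hR, ?_⟩
    obtain ⟨us, rfl⟩ := (List.map_surjective_iff.mpr Ideal.Quotient.mk_surjective) ts
    have hx0 : x ≠ 0 := fun h0 => hx2 (h0 ▸ zero_mem _)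
    refine ⟨x :: us, ?_, ?_⟩
    · rw [← Ideal.map_ofList, ← hmax] at hts
      have := congrArg (Ideal.comap (Ideal.Quotient.mk (Ideal.span {x}))) hts
      rwa [Ideal.comap_map_of_surjective _ Ideal.Quotient.mk_surjective,
        Ideal.comap_map_of_surjective _ Ideal.Quotient.mk_surjective, ← RingHom.ker_eq_comap_bot,
        Ideal.mk_ker, sup_comm, ← Ideal.ofList_cons,
        sup_eq_left.mpr ((Ideal.span_singleton_le_iff_mem _).mpr hxm)] at this
    · rw [isWeaklyRegular_cons_iff]
      refine ⟨isSMulRegular_iff_right_eq_zero_of_smul.mpr fun y hy => by simpa [hx0] using hy, ?_⟩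
      have h1 := (isWeaklyRegular_map_algebraMap_iff (R ⧸ Ideal.span {x})
        (R ⧸ Ideal.span {x}) us).mp hreg
      refine (LinearEquiv.isWeaklyRegular_congr (Submodule.quotEquivOfEq _ _ ?_) us).mp h1
      simp [← Submodule.ideal_span_singleton_smul]

end Regular

section FrobeniusPower

theorem frobeniusPower_eq_map {R : Type*} [CommRing R] (p : ℕ) [ExpChar R p] (e : ℕ)
    (J : Ideal R) : frobeniusPower J (p ^ e) = J.map (iterateFrobenius R p e) := rfl

theorem mem_frobeniusPower_of_mul_mem {R : Type*} [CommRing R] [IsLocalRing R] (p : ℕ)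
    [Fact p.Prime] [CharP R p] (hreg : IsRegularLocal R) {P : Ideal R} (hP : P.IsPrime) (e : ℕ)
    {a b : R} (hab : a * b ∈ frobeniusPower P (p ^ e)) (ha : a ∉ P) :
    b ∈ frobeniusPower P (p ^ e) := by
  obtain ⟨_, s, hs, hcard⟩ := hreg
  have hs' : Ideal.ofList s.toList = maximalIdeal R := by
    rw [← hs, Ideal.ofList]
    congr 1
    ext
    simp
  obtain ⟨_, ts, hts, hwreg⟩ := isDomain_and_exists_isWeaklyRegular s.card s.toList hs'
    s.length_toList hcard.le
  have : ExpChar R p := ExpChar.prime Fact.out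
  rw [frobeniusPower_eq_map] at hab ⊢
  have hcol : P.colon {a} ≤ P := fun r hr =>
    (hP.mem_or_mem (Submodule.mem_colon_singleton.mp hr)).resolve_right ha
  refine Ideal.map_mono hcol (colon_map_iterateFrobenius p e hwreg hts P a ?_)
  rw [Submodule.mem_colon_singleton, smul_eq_mul, iterateFrobenius_def]
  have hpos : p ^ e ≠ 0 := pow_ne_zero _ (Fact.out : p.Prime).ne_zero
  obtain ⟨n, hn⟩ := Nat.exists_eq_succ_of_ne_zero hpos
  rw [hn, pow_succ, mul_comm, mul_assoc]
  exact Ideal.mul_mem_left _ _ hab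

theorem not_le_frobeniusPower {R : Type*} [CommRing R] [IsLocalRing R] [IsNoetherianRing R]
    {P : Ideal R} (hP : P ≠ ⊤) (hP0 : P ≠ ⊥) {q : ℕ} (hq : 2 ≤ q) :
    ¬ P ≤ frobeniusPower P q := fun hle => by
  refine hP0 (Submodule.eq_bot_of_le_smul_of_le_jacobson_bot P P (IsNoetherian.noetherian _)
    (hle.trans (Ideal.span_le.mpr ?_)) ((le_maximalIdeal hP).trans (maximalIdeal_le_jacobson ⊥)))
  rintro _ ⟨x, hx, rfl⟩
  rw [smul_eq_mul, ← pow_two]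
  exact Ideal.pow_le_pow_right hq (Ideal.pow_mem_pow hx q)

end FrobeniusPower

end

/-- in a regular local ring of characteristic `p > 0`, for a nonzero
prime ideal `P` and `q = p^e` with `e ≥ 1`, the ideal `(P^{[q]} : P)` is `P`-primary. -/
theorem colon_frobeniusPower_isPrimary {R : Type*} [CommRing R] [IsLocalRing R] (p : ℕ)
    [Fact p.Prime] [CharP R p] (hreg : IsRegularLocal R)
    (P : Ideal R) (hP : P.IsPrime) (hP0 : P ≠ ⊥) (e : ℕ) (he : 1 ≤ e) :
    (Submodule.colon (frobeniusPower P (p ^ e)) P).IsPrimary ∧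
      (Submodule.colon (frobeniusPower P (p ^ e)) P).radical = P := by
  have := hreg.1
  have hq : 2 ≤ p ^ e := (Fact.out : p.Prime).two_le.trans (Nat.le_self_pow (by omega) p)
  have key {a b : R} (hab : a * b ∈ Submodule.colon (frobeniusPower P (p ^ e)) P) (ha : a ∉ P) :
      b ∈ Submodule.colon (frobeniusPower P (p ^ e)) P := by
    rw [Submodule.mem_colon] at hab ⊢
    intro x hx
    have h := hab x hx
    rw [smul_eq_mul, mul_assoc] at h
    exact mem_frobeniusPower_of_mul_mem p hreg hP e h ha
  have hle : Submodule.colon (frobeniusPower P (p ^ e)) P ≤ P := fun a ha => by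
    by_contra haP
    have h1 := key (b := 1) (by rwa [mul_one]) haP
    refine not_le_frobeniusPower hP.ne_top hP0 hq fun x hx => ?_
    simpa using Submodule.mem_colon.mp h1 x hx
  have hrad : (Submodule.colon (frobeniusPower P (p ^ e)) P).radical = P := by
    refine le_antisymm (hP.radical_le_iff.mpr hle) fun x hx => ⟨p ^ e, ?_⟩
    exact Submodule.mem_colon.mpr fun y _ =>
      Ideal.mul_mem_right _ _ (Ideal.subset_span ⟨x, hx, rfl⟩)
  refine ⟨Ideal.isPrimary_iff.mpr ⟨fun htop => hP.ne_top (top_le_iff.mp (htop ▸ hle)), ?_⟩, hrad⟩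
  intro a b hab
  rw [hrad]
  by_cases hb : b ∈ P
  · exact Or.inr hb
  · exact Or.inl (key (by rwa [mul_comm]) hb)
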